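/- Let α be a cascading n-sequence and RC(α) = (ν₁, ..., ν_n). Then for every m in {1, ..., n}, any two strings of ν_m of equal length have equal riggings. -/

import Mathlib

namespace CascRC

abbrev RP := Multiset (ℕ × ℤ)
abbrev RC := ℕ → RP

/-- The Cartan matrix of type `A`. -/
def cartanA (a b : ℕ) : ℤ :=
  if a = b then 2 else if b = a + 1 ∨ a = b + 1 then -1 else 0

/-- The smallest rigging of a rigged partition (0 if empty). -/
noncomputable def minRig (ν : RP) : ℤ :=
  if h : ν = 0 then 0
  else (ν.map Prod.snd).toFinset.min'
    (Multiset.toFinset_nonempty.mpr (by simpa [Multiset.map_eq_zero] using h))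

/-- The greatest length of a string whose rigging is the smallest rigging. -/
noncomputable def selLen (ν : RP) : ℕ :=
  ((ν.filter (fun s => s.2 = minRig ν)).map Prod.fst).sup

/-- The Kashiwara operator `f_a` on rigged configurations. -/
noncomputable def fOp (a : ℕ) (R : RC) : RC :=
  if R a = 0 ∨ 0 < minRig (R a) then
    fun b => (if b = a then ({(1, -1)} : RP) else 0)
      + (R b).map (fun s => if 0 < s.1 then (s.1, s.2 - cartanA a b) else s)
  else
    fun b =>
      (if b = a then ({(selLen (R a) + 1, minRig (R a) - 1)} : RP) else 0)
      + ((if b = a then (R a).erase (selLen (R a), minRig (R a)) else R b).map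
          (fun s => if selLen (R a) < s.1 then (s.1, s.2 - cartanA a b) else s))

/-- A list `γ` acts by `f_γ = f_{γ_p} ∘ ⋯ ∘ f_{γ₁}`. -/
noncomputable def fList (γ : List ℕ) (R : RC) : RC :=
  γ.foldl (fun S a => fOp a S) R

def emptyRC : RC := fun _ => 0

/-- `RC(α)`: the result of the list `α` acting on the empty rigged configuration. -/
noncomputable def RCseq (α : List ℕ) : RC := fList α emptyRC

/-- The `m`-lower subinterval `(a, a+1, …, m)`. -/
def lowerInt (a m : ℕ) : List ℕ := List.range' a (m + 1 - a)

def IsLowerIv (n : ℕ) (p : ℕ × ℕ) : Prop := 1 ≤ p.1 ∧ p.1 ≤ p.2 ∧ p.2 ≤ n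

/-- Ordering between consecutive lower subintervals in a cascading sequence. -/
def CascCh (p q : ℕ × ℕ) : Prop := q.2 < p.2 ∨ (q.2 = p.2 ∧ p.1 ≤ q.1)

/-- `ivs` is the lower-subinterval decomposition of a cascading `n`-sequence. -/
def IsCascDecomp (n : ℕ) (ivs : List (ℕ × ℕ)) : Prop :=
  (∀ p ∈ ivs, IsLowerIv n p) ∧ ivs.Chain' CascCh

/-- The integer sequence determined by a decomposition into lower subintervals. -/
def seqOf (ivs : List (ℕ × ℕ)) : List ℕ :=
  (ivs.map (fun p => lowerInt p.1 p.2)).flatten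

/-- `R_k`: the rigged configuration corresponding to `I_1 ⋯ I_k`. -/
noncomputable def Rk (ivs : List (ℕ × ℕ)) (k : ℕ) : RC :=
  RCseq (seqOf (ivs.take k))

/-- Height of column `c` of (the underlying partition of) a rigged partition. -/
def colHt (ν : RP) (c : ℕ) : ℕ := (ν.filter (fun s => c ≤ s.1)).card

/-- Length of the `i`-th row (1-based) of the underlying partition. -/
def rowLen (ν : RP) (i : ℕ) : ℕ :=
  ((Finset.Icc 1 ((ν.map Prod.fst).sup)).filter (fun c => i ≤ colHt ν c)).card

/-- Length of the uppermost row of length at most `L` (0 for the virtual empty row). -/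
def upRowLen (ν : RP) (L : ℕ) : ℕ := rowLen ν (colHt ν (L + 1) + 1)

/-- The column to which an application of `f_a` adds a box. -/
noncomputable def selCol (a : ℕ) (R : RC) : ℕ :=
  if R a = 0 ∨ 0 < minRig (R a) then 1 else selLen (R a) + 1

/-- Given a lower subinterval `p = (a, m)` acting on `R`, the column to which the
operator `f_l` occurring in it adds a box in the `l`-th partition. -/
noncomputable def ivCol (p : ℕ × ℕ) (l : ℕ) (R : RC) : ℕ :=
  selCol l (fList (lowerInt p.1 (l - 1)) R)

/-- Lengths `|r_a|, |r_{a+1}|, …` of the rows `r_i` of Lemma "snake":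
`rLenSeq R a (i - a) = |r_i|`. -/
def rLenSeq (R : RC) (a : ℕ) : ℕ → ℕ
  | 0 => rowLen (R a) 1
  | k + 1 => upRowLen (R (a + k + 1)) (rLenSeq R a k)


lemma colHt_anti (ν : RP) {c d : ℕ} (h : c ≤ d) : colHt ν d ≤ colHt ν c :=
  Multiset.card_le_card (Multiset.monotone_filter_right ν fun _ hs => h.trans hs)

lemma colHt_eq_of_no_row {ν : RP} {c d : ℕ} (h : c ≤ d)
    (hν : ∀ s ∈ ν, c ≤ s.1 → d ≤ s.1) : colHt ν c = colHt ν d := by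
  unfold colHt
  rw [Multiset.filter_congr fun s hs => ⟨hν s hs, h.trans⟩]

lemma no_row_of_colHt_le {ν : RP} {c d : ℕ} (h : c ≤ d) (hle : colHt ν c ≤ colHt ν d) :
    ∀ s ∈ ν, c ≤ s.1 → d ≤ s.1 := by
  intro s hs hc
  have heq := Multiset.eq_of_le_of_card_le
    (Multiset.monotone_filter_right ν fun (s : ℕ × ℤ) (hs : d ≤ s.1) => h.trans hs) hle
  have hmem : s ∈ ν.filter (fun s => c ≤ s.1) := Multiset.mem_filter.mpr ⟨hs, hc⟩
  rw [← heq] at hmem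
  exact (Multiset.mem_filter.mp hmem).2

lemma colHt_eq_zero {ν : RP} {c : ℕ} (h : ∀ s ∈ ν, s.1 < c) : colHt ν c = 0 := by
  unfold colHt
  rw [Multiset.filter_eq_nil.mpr fun s hs => not_le.mpr (h s hs), Multiset.card_zero]

/-- Subtract `z` from the rigging of a string longer than `l`. -/
def shift (l : ℕ) (z : ℤ) (s : ℕ × ℤ) : ℕ × ℤ := if l < s.1 then (s.1, s.2 - z) else s

@[simp] lemma shift_fst (l : ℕ) (z : ℤ) (s : ℕ × ℤ) : (shift l z s).1 = s.1 := by
  unfold shift; split_ifs <;> rfl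

lemma shift_snd (l : ℕ) (z : ℤ) (s : ℕ × ℤ) :
    (shift l z s).2 = s.2 - if l < s.1 then z else 0 := by
  unfold shift; split_ifs <;> simp

@[simp] lemma colHt_map_shift (l : ℕ) (z : ℤ) (ν : RP) (c : ℕ) :
    colHt (ν.map (shift l z)) c = colHt ν c := by
  unfold colHt
  rw [Multiset.filter_map, Multiset.card_map]
  simp

lemma colHt_add (ν μ : RP) (c : ℕ) : colHt (ν + μ) c = colHt ν c + colHt μ c := by
  simp [colHt]

lemma colHt_singleton (s : ℕ × ℤ) (c : ℕ) :
    colHt {s} c = if c ≤ s.1 then 1 else 0 := by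
  unfold colHt
  rw [Multiset.filter_singleton]
  split_ifs <;> simp

lemma minRig_eq {ν : RP} {l : ℕ} {x : ℤ} (hmem : (l, x) ∈ ν) (hmin : ∀ s ∈ ν, x ≤ s.2) :
    minRig ν = x := by
  have h0 : ν ≠ 0 := fun h => by simp [h] at hmem
  unfold minRig
  rw [dif_neg h0]
  apply le_antisymm
  · exact Finset.min'_le _ _ (by simpa using ⟨l, hmem⟩)
  · refine Finset.le_min' _ _ _ fun y hy => ?_
    simp only [Multiset.mem_toFinset, Multiset.mem_map] at hy
    obtain ⟨s, hs, rfl⟩ := hy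
    exact hmin s hs

lemma selLen_eq {ν : RP} {l : ℕ} {x : ℤ} (hmem : (l, x) ∈ ν) (hmin : ∀ s ∈ ν, x ≤ s.2)
    (hmax : ∀ s ∈ ν, s.2 = x → s.1 ≤ l) : selLen ν = l := by
  unfold selLen
  rw [minRig_eq hmem hmin]
  apply le_antisymm
  · refine Multiset.sup_le.mpr fun y hy => ?_
    simp only [Multiset.mem_map, Multiset.mem_filter] at hy
    obtain ⟨s, ⟨hs, hx⟩, rfl⟩ := hy
    exact hmax s hs hx
  · exact Multiset.le_sup (Multiset.mem_map.mpr ⟨(l, x), by simpa using hmem, rfl⟩)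

lemma minRig_pos {ν : RP} (h0 : ν ≠ 0) (h : ∀ s ∈ ν, 0 < s.2) : 0 < minRig ν := by
  unfold minRig
  rw [dif_neg h0, Finset.lt_min'_iff]
  intro y hy
  simp only [Multiset.mem_toFinset, Multiset.mem_map] at hy
  obtain ⟨s, hs, rfl⟩ := hy
  exact h s hs

/-- A uniform description of `f_i`: the new row is regarded as replacing a virtual row `(0, 0)`. -/
lemma fOp_eq {R : RC} {i l : ℕ} {x : ℤ} (hpos : ∀ s ∈ R i, 1 ≤ s.1)
    (hx : x ≤ 0) (hmin : ∀ s ∈ R i, x ≤ s.2) (hmax : ∀ s ∈ R i, s.2 = x → s.1 ≤ l)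
    (hmem : (l, x) ∈ R i ∨ l = 0 ∧ x = 0) :
    fOp i R i = {(l + 1, x - 1)} + ((R i).erase (l, x)).map (shift l 2) ∧
      ∀ b, b ≠ i → fOp i R b = (R b).map (shift l (cartanA i b)) := by
  have h2 : cartanA i i = 2 := by simp [cartanA]
  rcases hmem with hmem | ⟨rfl, rfl⟩
  · have h0 : R i ≠ 0 := fun h => by simp [h] at hmem
    have hneg : ¬ (R i = 0 ∨ 0 < minRig (R i)) := by
      rw [minRig_eq hmem hmin]
      exact not_or.mpr ⟨h0, not_lt.mpr hx⟩
    unfold fOp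
    rw [if_neg hneg, minRig_eq hmem hmin, selLen_eq hmem hmin hmax]
    refine ⟨?_, fun b hb => ?_⟩
    · simp only [if_true, h2]; rfl
    · simp only [if_neg hb, zero_add]; rfl
  · have hp : ∀ s ∈ R i, 0 < s.2 := fun s hs => by
      have := hmin s hs
      have := hpos s hs
      rcases eq_or_ne s.2 0 with h | h
      · have := hmax s hs h
        omega
      · omega
    have hc : R i = 0 ∨ 0 < minRig (R i) :=
      or_iff_not_imp_left.mpr fun h0 => minRig_pos h0 hp
    have hnm : ((0 : ℕ), (0 : ℤ)) ∉ R i := fun h => absurd (hpos _ h) (by simp)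
    unfold fOp
    rw [if_pos hc, Multiset.erase_of_notMem hnm]
    refine ⟨?_, fun b hb => ?_⟩
    · simp only [if_true, h2]; rfl
    · simp only [if_neg hb, zero_add]; rfl

/-- Effect of `f_i` when the strings of `ν_i` longer than `L` have just been raised by one:
a box is added to the uppermost row of length at most `L`. -/
lemma fOp_step {R : RC} {i c L : ℕ} {x : ℤ} (hpos : ∀ s ∈ R i, 1 ≤ s.1)
    (hx : x ≤ 0) (hcx : c = 0 → x = 0) (hcL : c ≤ L) (hc : c = 0 ∨ ∃ s ∈ R i, s.1 = c)
    (hmin : ∀ s ∈ R i, x ≤ s.2 - if L < s.1 then 1 else 0)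
    (heq : ∀ s ∈ R i, c ≤ s.1 → s.2 - (if L < s.1 then 1 else 0) = x) :
    ∃ l, c ≤ l ∧ l ≤ L ∧ (∀ s ∈ R i, l + 1 ≤ s.1 → L + 1 ≤ s.1) ∧
      (∀ s ∈ fOp i R i, l < s.1 ∧ s.2 = x - 1 ∨ s.1 ≤ l ∧ s ∈ R i) ∧
      (∀ d, 1 ≤ d → colHt (fOp i R i) d = colHt (R i) d + if d = l + 1 then 1 else 0) ∧
      (∃ s ∈ fOp i R i, s.1 = l + 1) ∧
      ∀ b, b ≠ i → fOp i R b = (R b).map (shift l (cartanA i b)) := by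
  classical
  obtain ⟨l, hcl, hlL, hl, hup⟩ : ∃ l, c ≤ l ∧ l ≤ L ∧ (l = 0 ∨ ∃ s ∈ R i, s.1 = l) ∧
      ∀ s ∈ R i, l + 1 ≤ s.1 → L + 1 ≤ s.1 := by
    let P : ℕ → Prop := fun l => l = 0 ∨ ∃ s ∈ R i, s.1 = l
    refine ⟨Nat.findGreatest P L, Nat.le_findGreatest hcL hc, Nat.findGreatest_le L,
      Nat.findGreatest_spec (P := P) (Nat.zero_le L) (Or.inl rfl), fun s hs h => ?_⟩
    by_contra hlt
    exact Nat.findGreatest_is_greatest (P := P) (Nat.lt_of_succ_le h) (by omega)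
      (Or.inr ⟨s, hs, rfl⟩)
  have hmem : (l, x) ∈ R i ∨ l = 0 ∧ x = 0 := by
    rcases hl with rfl | ⟨s, hs, rfl⟩
    · exact Or.inr ⟨rfl, hcx (by omega)⟩
    · have := heq s hs hcl
      rw [if_neg (by omega), sub_zero] at this
      exact Or.inl (this ▸ hs)
  obtain ⟨hi, hb⟩ := fOp_eq (l := l) hpos hx
    (fun s hs => by have := hmin s hs; split_ifs at this <;> omega)
    (fun s hs h => by
      have h1 := hmin s hs
      by_contra hlt
      have := hup s hs (by omega)
      rw [if_pos (by omega)] at h1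
      omega) hmem
  refine ⟨l, hcl, hlL, hup, ?_, ?_, ?_, hb⟩
  · intro s hs
    rw [hi, Multiset.mem_add, Multiset.mem_singleton, Multiset.mem_map] at hs
    rcases hs with rfl | ⟨t, ht, rfl⟩
    · exact Or.inl ⟨by simp, rfl⟩
    · have ht := Multiset.mem_of_mem_erase ht
      by_cases h : l < t.1
      · have h1 := heq t ht (by omega)
        have := hup t ht h
        rw [if_pos (by omega)] at h1
        refine Or.inl ⟨by simpa using h, ?_⟩
        rw [shift_snd, if_pos h]
        omega
      · refine Or.inr ⟨by simpa using h, ?_⟩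
        rwa [shift, if_neg h]
  · intro d hd
    rw [hi, colHt_add, colHt_singleton, colHt_map_shift]
    rcases hmem with hmem | ⟨rfl, rfl⟩
    · have h := colHt_add {(l, x)} ((R i).erase (l, x)) d
      rw [Multiset.singleton_add, Multiset.cons_erase hmem, colHt_singleton] at h
      simp only at h ⊢
      split_ifs at h ⊢ <;> omega
    · rw [Multiset.erase_of_notMem fun h => absurd (hpos _ h) (by simp)]
      simp only
      split_ifs <;> omega
  · exact ⟨(l + 1, x - 1), by rw [hi]; simp, rfl⟩

/-- Strings of equal length have equal riggings. -/
def EqRig (ν : RP) : Prop := ∀ s ∈ ν, ∀ t ∈ ν, s.1 = t.1 → s.2 = t.2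

lemma EqRig.map_shift {ν : RP} (h : EqRig ν) (l : ℕ) (z : ℤ) : EqRig (ν.map (shift l z)) := by
  intro s' hs' t' ht' hst
  obtain ⟨s, hs, rfl⟩ := Multiset.mem_map.mp hs'
  obtain ⟨t, ht, rfl⟩ := Multiset.mem_map.mp ht'
  simp only [shift_fst] at hst
  rw [shift_snd, shift_snd, h s hs t ht hst, hst]

/-- The state between two lower subintervals, where the last one was `(a, m)`, and `c j` is the
column to which its operator `f_j` added a box. The value `c = 0` describes a state in which no
subinterval ending in `m` was applied. -/
structure Boundary (m a : ℕ) (c : ℕ → ℕ) (x : ℤ) (R : RC) : Prop where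
  pos : ∀ j, ∀ s ∈ R j, 1 ≤ s.1
  lower : ∀ j < m, ∀ d, 1 ≤ d → colHt (R j) d ≤ colHt (R (j + 1)) d
  upper : ∀ j < m, ∀ d, 1 ≤ d → colHt (R (j + 1)) d ≤ colHt (R j) d + 1
  zero : ∀ j < m, ∀ s ∈ R j, s.2 = 0
  eqRig : ∀ j, m ≤ j → EqRig (R j)
  nonpos : x ≤ 0
  col_zero : c m = 0 → x = 0
  min : ∀ s ∈ R m, x ≤ s.2
  rig : ∀ s ∈ R m, c m ≤ s.1 → s.2 = x
  row : ∀ j, a ≤ j → j ≤ m → c j = 0 ∨ ∃ s ∈ R j, s.1 = c j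
  anti : ∀ j, a ≤ j → j + 1 ≤ m → c (j + 1) ≤ c j

/-- The state inside a lower subinterval `(a, m)`, just before its operator `f_i`, where
`f_{i-1}` selected a row of length `L`. For `j < i`, `c j` is the column to which `f_j` added a
box; for `j ≥ i` it is the corresponding column of the preceding subinterval. -/
structure Inside (m a i L : ℕ) (c : ℕ → ℕ) (x : ℤ) (R : RC) : Prop where
  pos : ∀ j, ∀ s ∈ R j, 1 ≤ s.1
  lower : ∀ j < m, ∀ d, 1 ≤ d →
    colHt (R j) d ≤ colHt (R (j + 1)) d + if j + 1 = i ∧ d = L + 1 then 1 else 0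
  upper : ∀ j < m, ∀ d, 1 ≤ d →
    colHt (R (j + 1)) d + (if j + 1 = i ∧ d = L + 1 then 1 else 0) ≤ colHt (R j) d + 1
  zero : ∀ j < m, ∀ s ∈ R j,
    s.2 = (if j = i ∧ L < s.1 then 1 else 0) - if j + 1 = i ∧ L < s.1 then 1 else 0
  eqRig : ∀ j, m ≤ j → EqRig (R j)
  nonpos : x ≤ 0
  col_zero : c m = 0 → x = 0
  min : ∀ s ∈ R m, x ≤ s.2 - if m = i ∧ L < s.1 then 1 else 0
  rig : ∀ s ∈ R m, c m ≤ s.1 → s.2 - (if m = i ∧ L < s.1 then 1 else 0) = x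
  row : ∀ j, a ≤ j → j ≤ m → c j = 0 ∨ ∃ s ∈ R j, s.1 = c j
  anti : ∀ j, a ≤ j → j + 1 ≤ m → j + 1 ≠ i → c (j + 1) ≤ c j
  col_le : i ≤ m → c i ≤ L
  lt_col : a < i → L + 1 ≤ c (i - 1)

lemma Boundary.inside {m a a' : ℕ} {c : ℕ → ℕ} {x : ℤ} {R : RC} (h : Boundary m a c x R)
    (ha : a ≤ a') (ham : a' ≤ m) (ha1 : 1 ≤ a') : ∃ L, Inside m a' a' L c x R := by
  obtain ⟨k, rfl⟩ : ∃ k, a' = k + 1 := ⟨a' - 1, by omega⟩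
  let L := ((R k + R (k + 1)).map Prod.fst).sup
  have hL : ∀ s ∈ R k + R (k + 1), s.1 ≤ L := fun s hs =>
    Multiset.le_sup (Multiset.mem_map_of_mem _ hs)
  have hLk : ∀ s ∈ R k, s.1 ≤ L := fun s hs => hL s (Multiset.mem_add.mpr (Or.inl hs))
  have hLk' : ∀ s ∈ R (k + 1), s.1 ≤ L := fun s hs => hL s (Multiset.mem_add.mpr (Or.inr hs))
  refine ⟨max L (c (k + 1)), h.pos, ?_, ?_, ?_, h.eqRig, h.nonpos, h.col_zero, ?_, ?_,
    fun j hj => h.row j (by omega), fun j hj hm _ => h.anti j (by omega) hm,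
    fun _ => le_max_right _ _, fun h => absurd h (lt_irrefl _)⟩
  · intro j hj d hd
    exact (h.lower j hj d hd).trans (Nat.le_add_right _ _)
  · intro j hj d hd
    have := h.upper j hj d hd
    split_ifs with hc
    · obtain ⟨h1, rfl⟩ := hc
      obtain rfl : j = k := by omega
      rw [colHt_eq_zero fun s hs => by have := hLk' s hs; omega]
      omega
    · exact this
  · intro j hj s hs
    rw [h.zero j hj s hs, if_neg, if_neg, sub_zero]
    · rintro ⟨h1, h2⟩
      obtain rfl : j = k := by omega
      have := hLk s hs
      omega
    · rintro ⟨rfl, h2⟩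
      have := hLk' s hs
      omega
  · intro s hs
    rw [if_neg, sub_zero]
    · exact h.min s hs
    · rintro ⟨rfl, h2⟩
      have := hLk' s hs
      omega
  · intro s hs hc
    rw [if_neg, sub_zero]
    · exact h.rig s hs hc
    · rintro ⟨rfl, h2⟩
      have := hLk' s hs
      omega

lemma Inside.boundary {m a L : ℕ} {c : ℕ → ℕ} {x : ℤ} {R : RC}
    (h : Inside m a (m + 1) L c x R) : Boundary m a c x R where
  pos := h.pos
  lower j hj d hd := by simpa [hj.ne] using h.lower j hj d hd
  upper j hj d hd := by simpa [hj.ne] using h.upper j hj d hd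
  zero j hj s hs := by
    simpa [hj.ne, (show j ≠ m + 1 by omega)] using h.zero j hj s hs
  eqRig := h.eqRig
  nonpos := h.nonpos
  col_zero := h.col_zero
  min s hs := by simpa using h.min s hs
  rig s hs hc := by simpa using h.rig s hs hc
  row := h.row
  anti j hj hm := h.anti j hj hm (by omega)

lemma Inside.step {m a i L : ℕ} {c : ℕ → ℕ} {x : ℤ} {R : RC} (h : Inside m a i L c x R)
    (hai : a ≤ i) (him : i ≤ m) (ha : 1 ≤ a) :
    ∃ l c' x', Inside m a (i + 1) l c' x' (fOp i R) := by
  -- `y` is the rigging that the row selected by `f_i` had at the last boundary.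
  obtain ⟨y, hy0, hcy, hmin, hrig, hyz, hym⟩ : ∃ y : ℤ, y ≤ 0 ∧ (c i = 0 → y = 0) ∧
      (∀ s ∈ R i, y ≤ s.2 - if L < s.1 then 1 else 0) ∧
      (∀ s ∈ R i, c i ≤ s.1 → s.2 - (if L < s.1 then 1 else 0) = y) ∧
      (i < m → y = 0) ∧ (i = m → y = x) := by
    rcases him.lt_or_eq with hlt | rfl
    · have hz : ∀ s ∈ R i, s.2 - (if L < s.1 then 1 else 0) = 0 := fun s hs => by
        have := h.zero i hlt s hs
        simp only [true_and, (show ¬ i + 1 = i by omega), false_and, if_false] at this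
        omega
      exact ⟨0, le_rfl, fun _ => rfl, fun s hs => (hz s hs).ge, fun s hs _ => hz s hs,
        fun _ => rfl, fun h => absurd h hlt.ne⟩
    · exact ⟨x, h.nonpos, h.col_zero, by simpa using h.min, by simpa using h.rig,
        fun h => absurd h (lt_irrefl _), fun _ => rfl⟩
  obtain ⟨l, hcl, hlL, hup, hmem, hht, hnew, hb⟩ :=
    fOp_step (h.pos i) hy0 hcy (h.col_le him) (h.row i hai him) hmin hrig
  obtain ⟨k, rfl⟩ : ∃ k, i = k + 1 := ⟨i - 1, by omega⟩
  have hbht : ∀ b, b ≠ k + 1 → ∀ d, colHt (fOp (k + 1) R b) d = colHt (R b) d :=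
    fun b hbi d => by rw [hb b hbi, colHt_map_shift]
  have hlow : ∀ d, 1 ≤ d → colHt (R k) d ≤ colHt (R (k + 1)) d + if d = L + 1 then 1 else 0 := by
    simpa using h.lower k (by omega)
  have hupp : ∀ d, 1 ≤ d →
      colHt (R (k + 1)) d + (if d = L + 1 then 1 else 0) ≤ colHt (R k) d + 1 := by
    simpa using h.upper k (by omega)
  have hgap : colHt (R (k + 1)) (l + 1) = colHt (R (k + 1)) (L + 1) :=
    colHt_eq_of_no_row (by omega) hup
  have hprev : ∀ s ∈ R k, l + 1 ≤ s.1 → L + 1 ≤ s.1 := by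
    rcases hlL.lt_or_eq with hlt | rfl
    · refine no_row_of_colHt_le (by omega) ?_
      have h1 := hlow (l + 1) (by omega)
      have h2 := hupp (L + 1) (by omega)
      rw [if_neg (by omega)] at h1
      rw [if_pos rfl] at h2
      omega
    · exact fun s _ hs => hs
  have hrow_ne : ∀ j, j ≠ k + 1 → ∀ e, (∃ s ∈ R j, s.1 = e) →
      ∃ s ∈ fOp (k + 1) R j, s.1 = e := by
    rintro j hj e ⟨s, hs, rfl⟩
    exact ⟨_, by rw [hb j hj]; exact Multiset.mem_map_of_mem _ hs, by simp⟩
  have hm : k + 1 < m → ∀ s ∈ fOp (k + 1) R m, ∃ t ∈ R m, t.1 = s.1 ∧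
      s.2 - (if m = k + 2 ∧ l < s.1 then 1 else 0) =
        t.2 - if m = k + 1 ∧ L < t.1 then 1 else 0 := by
    intro hlt s hs
    rw [hb m (by omega)] at hs
    obtain ⟨t, ht, rfl⟩ := Multiset.mem_map.mp hs
    refine ⟨t, ht, by simp, ?_⟩
    simp only [shift_fst, shift_snd, cartanA]
    split_ifs <;> omega
  refine ⟨l, Function.update c (k + 1) (l + 1), if k + 1 = m then x - 1 else x,
    ?_, ?_, ?_, ?_, ?_, ?_, ?_, ?_, ?_, ?_, ?_, ?_, ?_⟩
  · intro j s hs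
    by_cases hj : j = k + 1
    · subst hj
      rcases hmem s hs with h1 | h1
      · omega
      · exact h.pos _ s h1.2
    · rw [hb j hj] at hs
      obtain ⟨t, ht, rfl⟩ := Multiset.mem_map.mp hs
      simpa using h.pos j t ht
  · intro j hj d hd
    by_cases h1 : j = k + 1
    · subst h1
      rw [hht d hd, hbht _ (by omega)]
      have := h.lower _ hj d hd
      simp only [true_and, (show ¬ k + 1 + 1 = k + 1 by omega), false_and, if_false] at this ⊢
      omega
    · by_cases h2 : j = k
      · subst h2
        rw [hht d hd, hbht _ (by omega)]
        have h3 := hlow d hd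
        simp only [(show ¬ j + 1 = j + 1 + 1 by omega), false_and, if_false]
        rcases hlL.lt_or_eq with hlt | rfl
        · by_cases hd' : d = L + 1
          · subst hd'
            have h4 := hlow L (by omega)
            rw [if_neg (by omega)] at h4
            have h5 := colHt_anti (R j) (show L ≤ L + 1 by omega)
            have h6 := colHt_anti (R (j + 1)) (show l + 1 ≤ L by omega)
            omega
          · rw [if_neg hd'] at h3
            omega
        · omega
      · rw [hbht _ (by omega), hbht _ (by omega)]
        have := h.lower _ hj d hd
        rw [if_neg (by omega)] at this ⊢
        exact this
  · intro j hj d hd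
    by_cases h1 : j = k + 1
    · subst h1
      rw [hht d hd, hbht _ (by omega)]
      have := h.upper _ hj d hd
      simp only [true_and, (show ¬ k + 1 + 1 = k + 1 by omega), false_and, if_false] at this ⊢
      omega
    · by_cases h2 : j = k
      · subst h2
        rw [hht d hd, hbht _ (by omega)]
        have h3 := hupp d hd
        simp only [(show ¬ j + 1 = j + 1 + 1 by omega), false_and, if_false]
        by_cases hd' : d = l + 1
        · subst hd'
          have h4 := hupp (L + 1) (by omega)
          rw [if_pos rfl] at h4 ⊢
          have h5 := colHt_anti (R j) (show l + 1 ≤ L + 1 by omega)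
          omega
        · rw [if_neg hd']
          omega
      · rw [hbht _ (by omega), hbht _ (by omega)]
        have := h.upper _ hj d hd
        rw [if_neg (by omega)] at this ⊢
        exact this
  · intro j hj s hs
    by_cases h1 : j = k + 1
    · subst h1
      have hy := hyz hj
      simp only [true_and, (show ¬ k + 1 = k + 1 + 1 by omega), false_and, if_false]
      rcases hmem s hs with ⟨h2, h3⟩ | ⟨h2, h3⟩
      · rw [if_pos h2]
        omega
      · have h4 := h.zero _ hj s h3
        simp only [true_and, (show ¬ k + 1 + 1 = k + 1 by omega), false_and, if_false] at h4
        rw [if_neg (by omega)] at h4 ⊢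
        omega
    · rw [hb j h1] at hs
      obtain ⟨t, ht, rfl⟩ := Multiset.mem_map.mp hs
      have h3 := h.zero _ hj t ht
      simp only [shift_fst, shift_snd, cartanA]
      by_cases h2 : j = k
      · subst h2
        have := hprev t ht
        split_ifs at h3 ⊢ <;> omega
      · split_ifs at h3 ⊢ <;> omega
  · intro j hj
    by_cases h1 : j = k + 1
    · subst h1
      intro s hs t ht hst
      rcases hmem s hs with ⟨h2, h3⟩ | ⟨h2, h3⟩ <;> rcases hmem t ht with ⟨h4, h5⟩ | ⟨h4, h5⟩
      · omega
      · omega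
      · omega
      · exact h.eqRig _ hj s h3 t h5 hst
    · rw [hb j h1]
      exact (h.eqRig j hj).map_shift _ _
  · have := h.nonpos
    split_ifs <;> omega
  · intro h1
    by_cases h2 : k + 1 = m
    · subst h2
      simp at h1
    · rw [Function.update_of_ne (Ne.symm h2)] at h1
      rw [if_neg h2]
      exact h.col_zero h1
  · intro s hs
    by_cases h2 : k + 1 = m
    · subst h2
      have := hym rfl
      rw [if_pos rfl, if_neg (by omega)]
      rcases hmem s hs with ⟨h2, h3⟩ | ⟨h2, h3⟩
      · omega
      · have h4 := hmin s h3
        rw [if_neg (by omega)] at h4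
        omega
    · obtain ⟨t, ht, h3, h4⟩ := hm (by omega) s hs
      rw [if_neg h2, h4]
      exact h.min t ht
  · intro s hs hc
    by_cases h2 : k + 1 = m
    · subst h2
      have := hym rfl
      rw [if_pos rfl, if_neg (by omega)]
      rw [Function.update_self] at hc
      rcases hmem s hs with ⟨h2, h3⟩ | ⟨h2, h3⟩ <;> omega
    · obtain ⟨t, ht, h3, h4⟩ := hm (by omega) s hs
      rw [if_neg h2, h4]
      rw [Function.update_of_ne (Ne.symm h2)] at hc
      exact h.rig t ht (by omega)
  · intro j hj hjm
    by_cases h1 : j = k + 1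
    · subst h1
      rw [Function.update_self]
      exact Or.inr hnew
    · rw [Function.update_of_ne h1]
      exact (h.row j hj hjm).imp_right (hrow_ne j h1 _)
  · intro j hj hjm hne
    rw [Function.update_of_ne (show j ≠ k + 1 by omega)]
    by_cases h1 : j = k
    · subst h1
      rw [Function.update_self]
      have := h.lt_col (by omega)
      simp only [Nat.add_sub_cancel] at this
      omega
    · rw [Function.update_of_ne (by omega)]
      exact h.anti j hj hjm (by omega)
  · intro hle
    rw [Function.update_of_ne (by omega)]
    exact (h.anti (k + 1) hai hle (by omega)).trans hcl
  · intro _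
    simp

lemma Inside.fList_range' {m a : ℕ} (ha : 1 ≤ a) (k : ℕ) :
    ∀ {i L : ℕ} {c : ℕ → ℕ} {x : ℤ} {R : RC}, Inside m a i L c x R → a ≤ i → i + k = m + 1 →
      ∃ c' x', Boundary m a c' x' (fList (List.range' i k) R) := by
  induction k with
  | zero =>
    intro i L c x R h _ hk
    obtain rfl : i = m + 1 := by omega
    exact ⟨c, x, h.boundary⟩
  | succ k ih =>
    intro i L c x R h hai hk
    obtain ⟨l, c', x', h'⟩ := h.step hai (by omega) ha
    exact ih h' (by omega) (by omega)

lemma Boundary.of_lt {m m' a : ℕ} {c : ℕ → ℕ} {x : ℤ} {R : RC} (h : Boundary m a c x R)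
    (hm : m' < m) : Boundary m' 0 0 0 R where
  pos := h.pos
  lower j hj := h.lower j (hj.trans hm)
  upper j hj := h.upper j (hj.trans hm)
  zero j hj := h.zero j (hj.trans hm)
  eqRig j _ := by
    rcases lt_or_ge j m with hlt | hge
    · exact fun s hs t ht _ => (h.zero j hlt s hs).trans (h.zero j hlt t ht).symm
    · exact h.eqRig j hge
  nonpos := le_rfl
  col_zero _ := rfl
  min s hs := (h.zero m' hm s hs).ge
  rig s hs _ := h.zero m' hm s hs
  row _ _ _ := Or.inl rfl
  anti _ _ _ := le_rfl

lemma boundary_emptyRC (m : ℕ) : Boundary m 0 0 0 emptyRC := by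
  constructor <;> simp [emptyRC, colHt, EqRig]

lemma Boundary.eqRig_fList {n : ℕ} (ivs : List (ℕ × ℕ)) :
    ∀ {p : ℕ × ℕ} {c : ℕ → ℕ} {x : ℤ} {R : RC}, Boundary p.2 p.1 c x R →
      (∀ q ∈ ivs, IsLowerIv n q) → (p :: ivs).IsChain CascCh →
      ∀ j, EqRig (fList (seqOf ivs) R j) := by
  induction ivs with
  | nil =>
    intro p c x R h _ _ j
    rcases lt_or_ge j p.2 with hlt | hge
    · exact fun s hs t ht _ => (h.zero j hlt s hs).trans (h.zero j hlt t ht).symm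
    · exact h.eqRig j hge
  | cons q ivs ih =>
    intro p c x R h hiv hch j
    obtain ⟨hpq, hch⟩ := List.isChain_cons_cons.mp hch
    obtain ⟨h1, h2, -⟩ := hiv q (by simp)
    have hin : ∃ L c x, Inside q.2 q.1 q.1 L c x R := by
      rcases hpq with hlt | ⟨heq, hle⟩
      · obtain ⟨L, hL⟩ := (h.of_lt hlt).inside (Nat.zero_le _) h2 h1
        exact ⟨L, _, _, hL⟩
      · rw [← heq] at h
        obtain ⟨L, hL⟩ := h.inside hle h2 h1
        exact ⟨L, _, _, hL⟩
    obtain ⟨L, c, x, hL⟩ := hin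
    obtain ⟨c', x', hb⟩ := hL.fList_range' h1 (q.2 + 1 - q.1) le_rfl (by omega)
    have := ih hb (fun r hr => hiv r (by simp [hr])) hch j
    simpa [seqOf, fList, lowerInt] using this

/-- Theorem "identical rows have identical riggings".
If `α` is a cascading `n`-sequence and `RC(α) = (ν₁, …, ν_n)`, then in each `ν_m`
any two strings of equal length have equal riggings. -/
theorem equal_length_equal_rigging (n : ℕ) (hn : 0 < n)
    (ivs : List (ℕ × ℕ)) (hc : IsCascDecomp n ivs) :
    ∀ m, 1 ≤ m → m ≤ n →
      ∀ s ∈ RCseq (seqOf ivs) m, ∀ t ∈ RCseq (seqOf ivs) m,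
        s.1 = t.1 → s.2 = t.2 := by
  intro m _ _
  obtain ⟨hiv, hch⟩ := hc
  refine Boundary.eqRig_fList (n := n) (p := (0, n + 1)) ivs (boundary_emptyRC _) hiv ?_ m
  refine List.isChain_cons.mpr ⟨fun q hq => Or.inl ?_, hch⟩
  exact Nat.lt_succ_of_le (hiv q (List.mem_of_mem_head? hq)).2.2

end CascRC
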